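/- Energy upper bound: there exists a constant c₁ > 0, depending only on 𝒦, θ₀, the family (μ_θ)_{θ∈Θ} and Θ, such that almost surely, (c₁/ε²)⟨μ_{θ̂_{n,ε}} − μ_{θ₀}, 𝒦(μ_{θ̂_{n,ε}} − μ_{θ₀})⟩ ≤ ε⁻²‖Kⁿ − K‖²_{L∞(T²)} + |(⟨∂_iμ_{θ₀}, Z⟩)_i|² + sup_{θ∈Θ}‖(⟨∂_i∂_jμ_θ, Z⟩)_{ij}‖_F² + |(⟨∂_i(μⁿ_{θ₀} − μ_{θ₀}), Z⟩)_i|² + sup_{θ∈Θ}‖(⟨∂_i∂_j(μⁿ_θ − μ_θ), Z⟩)_{ij}‖_F², where ‖·‖_F is the Frobenius norm and |·| the Euclidean norm on ℝᵖ. -/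

import Mathlib

open Filter MeasureTheory ProbabilityTheory Topology Matrix

noncomputable section

/-- The Dirac measure at `x`, as a bounded linear functional on `C([a,b])`. -/
def dirac {a b : ℝ} (x : Set.Icc a b) : C(Set.Icc a b, ℝ) →L[ℝ] ℝ :=
  LinearMap.mkContinuous
    { toFun := fun f => f x
      map_add' := by intro f g; simp
      map_smul' := by intro c f; simp }
    1 (fun f => by simpa using f.norm_coe_le_norm x)

/-- Continuous functions converging pointwise (as `k → ∞`) to the indicator of `[a,u]`. -/
def gbump (a b u : ℝ) (k : ℕ) : C(Set.Icc a b, ℝ) :=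
  ⟨fun x => max 0 (min 1 (1 - k * (x.1 - u))), by fun_prop⟩

/-- The coefficients `μ(Tᵢ)` of the discretization of `μ`, via the cumulative distribution
function `F μ u = μ([a,u])`. -/
def coef {a b : ℝ} (F : (C(Set.Icc a b, ℝ) →L[ℝ] ℝ) → ℝ → ℝ) (t : ℕ → ℕ → Set.Icc a b)
    (n : ℕ) (μ : C(Set.Icc a b, ℝ) →L[ℝ] ℝ) (i : ℕ) : ℝ :=
  if i = 1 then F μ (t n 1) else F μ (t n i) - F μ (t n (i - 1))

/-- The discretized measure `μⁿ = ∑ᵢ μ(Tᵢ) δ_{tᵢ}`. -/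
def muDisc {a b : ℝ} (F : (C(Set.Icc a b, ℝ) →L[ℝ] ℝ) → ℝ → ℝ) (t : ℕ → ℕ → Set.Icc a b)
    (n : ℕ) (μ : C(Set.Icc a b, ℝ) →L[ℝ] ℝ) : C(Set.Icc a b, ℝ) →L[ℝ] ℝ :=
  ∑ i ∈ Finset.Icc 1 n, coef F t n μ i • dirac (t n i)

/-- The discrete contrast `Φₙ(μ; x) = ∑ᵢ μ(Tᵢ) x(tᵢ) − ½ ∑ᵢⱼ μ(Tᵢ)μ(Tⱼ)K(tᵢ,tⱼ)`. -/
def contrastD {a b : ℝ} (F : (C(Set.Icc a b, ℝ) →L[ℝ] ℝ) → ℝ → ℝ) (t : ℕ → ℕ → Set.Icc a b)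
    (K : C(Set.Icc a b × Set.Icc a b, ℝ)) (n : ℕ)
    (μ : C(Set.Icc a b, ℝ) →L[ℝ] ℝ) (x : C(Set.Icc a b, ℝ)) : ℝ :=
  (∑ i ∈ Finset.Icc 1 n, coef F t n μ i * x (t n i)) -
    (1 / 2) * ∑ i ∈ Finset.Icc 1 n, ∑ j ∈ Finset.Icc 1 n,
      coef F t n μ i * coef F t n μ j * K (t n i, t n j)

/-- The partition cell `Tᵢ`: `T₁ = [t₀, t₁]`, `Tᵢ = (tᵢ₋₁, tᵢ]` for `i ≥ 2`. -/
def TSet {a b : ℝ} (t : ℕ → ℕ → Set.Icc a b) (n i : ℕ) : Set ℝ :=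
  if i = 1 then Set.Icc ((t n 0 : ℝ)) ((t n 1 : ℝ)) else Set.Ioc ((t n (i - 1) : ℝ)) ((t n i : ℝ))

/-- `‖Kⁿ − K‖_{L^∞(T²)}`. -/
def KnDiff {a b : ℝ} (K : C(Set.Icc a b × Set.Icc a b, ℝ))
    (Kn : ℕ → Set.Icc a b → Set.Icc a b → ℝ) (n : ℕ) : ℝ :=
  ⨆ su : Set.Icc a b × Set.Icc a b, |Kn n su.1 su.2 - K su|

/-- Frobenius norm of a `p × p` real matrix. -/
def frob {p : ℕ} (M : Fin p → Fin p → ℝ) : ℝ :=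
  Real.sqrt (∑ i, ∑ j, (M i j) ^ 2)

/-- The continuous linear map `ℝᵖ →L M(T)` determined by the partial derivatives `v i`. -/
def clmOfPartials {a b : ℝ} {p : ℕ} (v : Fin p → (C(Set.Icc a b, ℝ) →L[ℝ] ℝ)) :
    EuclideanSpace ℝ (Fin p) →L[ℝ] (C(Set.Icc a b, ℝ) →L[ℝ] ℝ) :=
  ∑ i, (EuclideanSpace.proj i).smulRight (v i)

section PositiveKernel

variable {E : Type*} [NormedAddCommGroup E] [NormedSpace ℝ E]

/-- Degenerate Cauchy-Schwarz: an isotropic functional lies in the radical of the form. -/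
lemma apply_eq_zero_of_isotropic (Kop : (E →L[ℝ] ℝ) →L[ℝ] E)
    (hpos : ∀ μ : E →L[ℝ] ℝ, 0 ≤ μ (Kop μ))
    (hsym : ∀ μ ν : E →L[ℝ] ℝ, μ (Kop ν) = ν (Kop μ))
    {μ : E →L[ℝ] ℝ} (hμ : μ (Kop μ) = 0) (ν : E →L[ℝ] ℝ) : ν (Kop μ) = 0 := by
  by_contra h
  have key := hpos (ν + (-(ν (Kop ν) + 1) / (2 * ν (Kop μ))) • μ)
  have e : (-(ν (Kop ν) + 1) / (2 * ν (Kop μ))) * ν (Kop μ) = -(ν (Kop ν) + 1) / 2 := by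
    field_simp
  simp only [map_add, map_smul, _root_.add_apply, _root_.smul_apply,
    smul_eq_mul, hμ, hsym μ ν, e] at key
  linarith

variable {W : Type*} [NormedAddCommGroup W] [NormedSpace ℝ W] [FiniteDimensional ℝ W]

lemma exists_pos_mul_sq_le_of_isotropic_eq_zero (Kop : (E →L[ℝ] ℝ) →L[ℝ] E)
    (hpos : ∀ μ : E →L[ℝ] ℝ, 0 ≤ μ (Kop μ)) (L : W →L[ℝ] (E →L[ℝ] ℝ))
    (hL : ∀ x, L x (Kop (L x)) = 0 → x = 0) :
    ∃ c > (0 : ℝ), ∀ x, c * ‖x‖ ^ 2 ≤ L x (Kop (L x)) := by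
  have hcont : Continuous fun x => L x (Kop (L x)) := by fun_prop
  obtain ⟨c, hc, hle⟩ := (isCompact_sphere (0 : W) 1).exists_forall_le' hcont.continuousOn
    (a := 0) (fun x hx => lt_of_le_of_ne (hpos _) fun h => by
      simp [hL x h.symm] at hx)
  refine ⟨c, hc, fun x => ?_⟩
  rcases eq_or_ne x 0 with rfl | hx
  · simp
  have hx' : ‖x‖ ≠ 0 := norm_ne_zero_iff.2 hx
  have h := hle (‖x‖⁻¹ • x) (by simp [norm_smul, hx'])
  simp only [map_smul, _root_.smul_apply, smul_eq_mul] at h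
  calc c * ‖x‖ ^ 2 ≤ (‖x‖⁻¹ * (‖x‖⁻¹ * L x (Kop (L x)))) * ‖x‖ ^ 2 := by gcongr
    _ = L x (Kop (L x)) := by field_simp

/-- Identifiability together with a nondegenerate derivative makes the energy of
`f x - f x₀` comparable from below to `‖x - x₀‖ ^ 2` on a compact set. -/
lemma exists_pos_mul_sq_le_energy (Kop : (E →L[ℝ] ℝ) →L[ℝ] E)
    (hpos : ∀ μ : E →L[ℝ] ℝ, 0 ≤ μ (Kop μ))
    (hsym : ∀ μ ν : E →L[ℝ] ℝ, μ (Kop ν) = ν (Kop μ))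
    {S : Set W} (hS : IsCompact S) {x₀ : W} (hx₀ : x₀ ∈ S) {f : W → (E →L[ℝ] ℝ)}
    (hf : ContinuousOn f S) {L : W →L[ℝ] (E →L[ℝ] ℝ)} (hfL : HasFDerivWithinAt f L S x₀)
    (hL : ∀ x, L x (Kop (L x)) = 0 → x = 0)
    (hident : ∀ x ∈ S, (f x - f x₀) (Kop (f x - f x₀)) = 0 → x = x₀) :
    ∃ c > (0 : ℝ), ∀ x ∈ S, c * ‖x - x₀‖ ^ 2 ≤ (f x - f x₀) (Kop (f x - f x₀)) := by
  obtain ⟨l, hl, hlL⟩ := exists_pos_mul_sq_le_of_isotropic_eq_zero Kop hpos L hL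
  have hQ : ContinuousOn (fun x => (f x - f x₀) (Kop (f x - f x₀))) S := by fun_prop
  refine hS.induction_on (p := fun s => ∃ c > (0 : ℝ), ∀ x ∈ s,
    c * ‖x - x₀‖ ^ 2 ≤ (f x - f x₀) (Kop (f x - f x₀))) ⟨1, one_pos, by simp⟩ ?_ ?_ ?_
  · rintro s t hst ⟨c, hc, h⟩
    exact ⟨c, hc, fun x hx => h x (hst hx)⟩
  · rintro s t ⟨c, hc, h⟩ ⟨d, hd, h'⟩
    refine ⟨min c d, lt_min hc hd, ?_⟩
    rintro x (hx | hx)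
    · exact (mul_le_mul_of_nonneg_right (min_le_left _ _) (by positivity)).trans (h x hx)
    · exact (mul_le_mul_of_nonneg_right (min_le_right _ _) (by positivity)).trans (h' x hx)
  · intro x hx
    rcases eq_or_ne x x₀ with rfl | hne
    · set η : ℝ := l / (4 * (‖Kop‖ * ‖L‖ + 1)) with hη
      have hηpos : 0 < η := by positivity
      have hη' : 2 * η * (‖Kop‖ * ‖L‖) ≤ l / 2 := by
        rw [hη, mul_div_assoc', div_mul_eq_mul_div, div_le_iff₀ (by positivity)]
        nlinarith [mul_nonneg (norm_nonneg Kop) (norm_nonneg L)]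
      refine ⟨_, (hfL.isLittleO.def hηpos), l / 2, by positivity, fun y hy => ?_⟩
      simp only [Set.mem_ofPred_eq] at hy
      set r := f y - f x - L (y - x) with hr
      have hdec : f y - f x = L (y - x) + r := by rw [hr]; abel
      have h1 : |r (Kop (L (y - x)))| ≤ η * (‖Kop‖ * ‖L‖) * ‖y - x‖ ^ 2 := by
        calc |r (Kop (L (y - x)))| ≤ ‖r‖ * ‖Kop (L (y - x))‖ := r.le_opNorm _
          _ ≤ (η * ‖y - x‖) * (‖Kop‖ * (‖L‖ * ‖y - x‖)) := by
            gcongr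
            exact (Kop.le_opNorm _).trans (by gcongr; exact L.le_opNorm _)
          _ = _ := by ring
      rw [hdec]
      simp only [map_add, _root_.add_apply, hsym (L (y - x)) r]
      have h2 := hpos r
      have h3 := hlL (y - x)
      have h4 := mul_le_mul_of_nonneg_right hη' (sq_nonneg ‖y - x‖)
      have h5 := neg_le_of_abs_le h1
      linarith
    · have hxpos : 0 < ‖x - x₀‖ ^ 2 := by
        have := sub_ne_zero.2 hne
        positivity
      have hQpos : 0 < (f x - f x₀) (Kop (f x - f x₀)) :=
        lt_of_le_of_ne (hpos _) fun h => hne (hident x hx h.symm)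
      set c : ℝ := (f x - f x₀) (Kop (f x - f x₀)) / (2 * ‖x - x₀‖ ^ 2) with hc
      have hlt : c * ‖x - x₀‖ ^ 2 < (f x - f x₀) (Kop (f x - f x₀)) := by
        rw [hc, div_mul_eq_mul_div, div_lt_iff₀ (by positivity)]
        nlinarith [mul_pos hQpos hxpos]
      have hcc : ContinuousWithinAt (fun y => c * ‖y - x₀‖ ^ 2) S x := by fun_prop
      have hev := hcc.eventually_lt (hQ x hx) hlt
      exact ⟨_, hev, c, by positivity, fun y hy => le_of_lt hy⟩

end PositiveKernel

section Taylor

variable {p : ℕ} {E : Type*} [NormedAddCommGroup E] [NormedSpace ℝ E]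

/-- The continuous linear map on `ℝᵖ` with values `v i` on the standard basis. -/
def partialsCLM (v : Fin p → (E →L[ℝ] ℝ)) : EuclideanSpace ℝ (Fin p) →L[ℝ] (E →L[ℝ] ℝ) :=
  ∑ i, (EuclideanSpace.proj i).smulRight (v i)

lemma partialsCLM_apply (v : Fin p → (E →L[ℝ] ℝ))
    (x : EuclideanSpace ℝ (Fin p)) : partialsCLM v x = ∑ i, x i • v i := by
  simp [partialsCLM]

lemma norm_partialsCLM_le (v : Fin p → (E →L[ℝ] ℝ)) :
    ‖partialsCLM v‖ ≤ ∑ i, ‖v i‖ := by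
  refine ContinuousLinearMap.opNorm_le_bound _ (by positivity) fun x => ?_
  rw [partialsCLM_apply, Finset.sum_mul]
  refine (norm_sum_le _ _).trans (Finset.sum_le_sum fun i _ => ?_)
  rw [norm_smul, mul_comm]
  gcongr
  exact PiLp.norm_apply_le x i

lemma abs_sum_mul_le_norm_mul_sqrt (x : EuclideanSpace ℝ (Fin p)) (w : Fin p → ℝ) :
    |∑ i, x i * w i| ≤ ‖x‖ * √(∑ i, w i ^ 2) := by
  rw [EuclideanSpace.norm_eq, ← Real.sqrt_mul (by positivity)]
  refine Real.abs_le_sqrt ?_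
  simpa using Finset.sum_mul_sq_le_sq_mul_sq Finset.univ (fun i => x i) w

lemma abs_quadratic_le_norm_sq_mul_frob (x : EuclideanSpace ℝ (Fin p)) (M : Fin p → Fin p → ℝ) :
    |∑ i, x i * ∑ j, x j * M j i| ≤ ‖x‖ ^ 2 * frob M := by
  refine (abs_sum_mul_le_norm_mul_sqrt x _).trans ?_
  rw [sq, mul_assoc]
  gcongr
  rw [Real.sqrt_le_left (by unfold frob; positivity), mul_pow, frob,
    Real.sq_sqrt (by positivity), Finset.sum_comm, Finset.mul_sum]
  refine Finset.sum_le_sum fun i _ => ?_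
  rw [EuclideanSpace.norm_sq_eq]
  simpa using Finset.sum_mul_sq_le_sq_mul_sq Finset.univ (fun j => x j) (fun j => M j i)

/-- Second order Taylor bound for a continuous functional of a `C²` family. -/
lemma abs_apply_sub_le_taylor {Θ : Set (EuclideanSpace ℝ (Fin p))} (hΘconv : Convex ℝ Θ)
    {θ₀ θ : EuclideanSpace ℝ (Fin p)} (hθ₀ : θ₀ ∈ Θ) (hθ : θ ∈ Θ)
    {μf : EuclideanSpace ℝ (Fin p) → (E →L[ℝ] ℝ)}
    {Dμ : EuclideanSpace ℝ (Fin p) → Fin p → (E →L[ℝ] ℝ)}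
    {D2μ : EuclideanSpace ℝ (Fin p) → Fin p → Fin p → (E →L[ℝ] ℝ)}
    (hD1 : ∀ θ ∈ Θ, HasFDerivWithinAt μf (partialsCLM (Dμ θ)) Θ θ)
    (hD2 : ∀ θ ∈ Θ, ∀ i, HasFDerivWithinAt (fun θ' => Dμ θ' i)
      (partialsCLM (fun j => D2μ θ j i)) Θ θ)
    (ψ : (E →L[ℝ] ℝ) →L[ℝ] ℝ) {B : ℝ}
    (hB : ∀ θ ∈ Θ, frob (fun i j => ψ (D2μ θ i j)) ≤ B) :
    |ψ (μf θ - μf θ₀)| ≤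
      ‖θ - θ₀‖ * √(∑ i, ψ (Dμ θ₀ i) ^ 2) + ‖θ - θ₀‖ ^ 2 * B := by
  set x := θ - θ₀ with hx
  have hB0 : 0 ≤ B := (Real.sqrt_nonneg _).trans (hB θ hθ)
  let γ : ℝ → EuclideanSpace ℝ (Fin p) := fun τ => θ₀ + τ • x
  have hγmaps : Set.MapsTo γ (Set.Icc 0 1) Θ := fun τ hτ => hΘconv.add_smul_sub_mem hθ₀ hθ hτ
  have hγ : ∀ τ, HasDerivWithinAt γ x (Set.Icc 0 1) τ := fun τ => by
    simpa [γ] using ((hasDerivWithinAt_id τ (Set.Icc (0 : ℝ) 1)).smul_const x).const_add θ₀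
  let g : ℝ → ℝ := fun τ => ∑ i, x i * ψ (Dμ (γ τ) i)
  have hf : ∀ τ ∈ Set.Icc (0 : ℝ) 1,
      HasDerivWithinAt (fun τ => ψ (μf (γ τ))) (g τ) (Set.Icc 0 1) τ := fun τ hτ => by
    have h := (hD1 (γ τ) (hγmaps hτ)).comp_hasDerivWithinAt τ (hγ τ) hγmaps
    have h' := ψ.hasFDerivAt.comp_hasDerivWithinAt τ h
    simpa [partialsCLM_apply, g, Function.comp_def] using h'
  have hg : ∀ τ ∈ Set.Icc (0 : ℝ) 1,
      HasDerivWithinAt g (∑ i, x i * ∑ j, x j * ψ (D2μ (γ τ) j i)) (Set.Icc 0 1) τ :=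
    fun τ hτ => by
      refine HasDerivWithinAt.fun_sum fun i _ => HasDerivWithinAt.const_mul _ ?_
      have h := (hD2 (γ τ) (hγmaps hτ) i).comp_hasDerivWithinAt τ (hγ τ) hγmaps
      have h' := ψ.hasFDerivAt.comp_hasDerivWithinAt τ h
      simpa [partialsCLM_apply, Function.comp_def] using h'
  have hgbound : ∀ τ ∈ Set.Icc (0 : ℝ) 1, ‖g τ - g 0‖ ≤ ‖x‖ ^ 2 * B := fun τ hτ => by
    have h := norm_image_sub_le_of_norm_deriv_le_segment' hg (C := ‖x‖ ^ 2 * B)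
      (fun σ hσ => (abs_quadratic_le_norm_sq_mul_frob x _).trans (by
        gcongr
        exact hB _ (hγmaps (Set.Ico_subset_Icc_self hσ)))) τ hτ
    refine h.trans (mul_le_of_le_one_right (by positivity) ?_)
    linarith [hτ.2]
  have hmain := norm_image_sub_le_of_norm_deriv_le_segment_01'
    (f := fun τ => ψ (μf (γ τ)) - τ * g 0) (f' := fun τ => g τ - g 0) (C := ‖x‖ ^ 2 * B)
    (fun τ hτ => (hf τ hτ).sub (by
      simpa using (hasDerivWithinAt_id τ (Set.Icc (0 : ℝ) 1)).mul_const (g 0)))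
    (fun τ hτ => hgbound τ (Set.Ico_subset_Icc_self hτ))
  have hγ0 : γ 0 = θ₀ := by simp [γ]
  have hγ1 : γ 1 = θ := by simp [γ, hx]
  have hg0 : |g 0| ≤ ‖x‖ * √(∑ i, ψ (Dμ θ₀ i) ^ 2) := by
    simpa only [g, hγ0] using abs_sum_mul_le_norm_mul_sqrt x fun i => ψ (Dμ θ₀ i)
  simp only [hγ0, hγ1, one_mul, zero_mul, sub_zero, Real.norm_eq_abs] at hmain
  rw [map_sub]
  have e : ψ (μf θ) - ψ (μf θ₀) = g 0 + (ψ (μf θ) - g 0 - ψ (μf θ₀)) := by ring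
  rw [e]
  exact (abs_add_le _ _).trans (add_le_add hg0 hmain)

lemma exists_norm_sub_le_mul_norm_sub {Θ : Set (EuclideanSpace ℝ (Fin p))} (hΘc : IsCompact Θ)
    (hΘconv : Convex ℝ Θ) {θ₀ : EuclideanSpace ℝ (Fin p)} (hθ₀ : θ₀ ∈ Θ)
    {f : EuclideanSpace ℝ (Fin p) → (E →L[ℝ] ℝ)} {Df : EuclideanSpace ℝ (Fin p) → Fin p → (E →L[ℝ] ℝ)}
    {D2f : EuclideanSpace ℝ (Fin p) → Fin p → Fin p → (E →L[ℝ] ℝ)}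
    (hD1 : ∀ θ ∈ Θ, HasFDerivWithinAt f (partialsCLM (Df θ)) Θ θ)
    (hD2 : ∀ θ ∈ Θ, ∀ i, HasFDerivWithinAt (fun θ' => Df θ' i)
      (partialsCLM (fun j => D2f θ j i)) Θ θ) :
    ∃ C ≥ (0 : ℝ), ∀ θ ∈ Θ, ‖f θ - f θ₀‖ ≤ C * ‖θ - θ₀‖ := by
  have hcont : ContinuousOn (fun θ => ∑ i, ‖Df θ i‖) Θ :=
    continuousOn_finsetSum _ fun i _ => ContinuousOn.norm fun θ hθ =>
      (hD2 θ hθ i).continuousWithinAt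
  obtain ⟨C, hC⟩ := hΘc.exists_bound_of_continuousOn hcont
  exact ⟨C, (norm_nonneg _).trans (hC θ₀ hθ₀), fun θ hθ =>
    hΘconv.norm_image_sub_le_of_norm_hasFDerivWithin_le hD1
      (fun θ' hθ' => (norm_partialsCLM_le _).trans ((le_abs_self _).trans (hC θ' hθ'))) hθ₀ hθ⟩

lemma exists_norm_le_of_continuousOn {Θ : Set (EuclideanSpace ℝ (Fin p))} (hΘc : IsCompact Θ)
    {D2f : EuclideanSpace ℝ (Fin p) → Fin p → Fin p → (E →L[ℝ] ℝ)} (h : ContinuousOn D2f Θ) :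
    ∃ C, ∀ θ ∈ Θ, ∀ i j, ‖D2f θ i j‖ ≤ C := by
  obtain ⟨C, hC⟩ := hΘc.exists_bound_of_continuousOn h
  exact ⟨C, fun θ hθ i j =>
    (norm_le_pi_norm _ j).trans ((norm_le_pi_norm _ i).trans (hC θ hθ))⟩

lemma bddAbove_range_of_abs_le {ι : Type*} {c : ι → ℝ} {M : ℝ} (h : ∀ i, |c i| ≤ M) :
    BddAbove (Set.range c) :=
  ⟨M, by rintro _ ⟨i, rfl⟩; exact (le_abs_self _).trans (h i)⟩

lemma frob_le_sqrt_biSup {Θ : Set (EuclideanSpace ℝ (Fin p))}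
    {M : EuclideanSpace ℝ (Fin p) → Fin p → Fin p → ℝ} {C : ℝ}
    (hM : ∀ θ ∈ Θ, ∀ i j, |M θ i j| ≤ C) :
    ∀ θ ∈ Θ, frob (M θ) ≤ √(⨆ θ ∈ Θ, frob (M θ) ^ 2) := by
  intro θ hθ
  refine Real.le_sqrt_of_sq_le ?_
  have hb : ∀ θ, |⨆ (_ : θ ∈ Θ), frob (M θ) ^ 2| ≤ ∑ _i : Fin p, ∑ _j : Fin p, C ^ 2 := by
    intro θ
    rw [abs_of_nonneg (Real.iSup_nonneg fun _ => sq_nonneg _)]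
    refine Real.iSup_le (fun hθ => ?_) (by positivity)
    rw [frob, Real.sq_sqrt (by positivity)]
    refine Finset.sum_le_sum fun i _ => Finset.sum_le_sum fun j _ => ?_
    exact sq_le_sq' (neg_le_of_abs_le (hM θ hθ i j)) (le_of_abs_le (hM θ hθ i j))
  refine le_trans (le_of_eq ?_) (le_ciSup (bddAbove_range_of_abs_le hb) θ)
  simp [hθ]

lemma frob_apply_le_sqrt_biSup {Θ : Set (EuclideanSpace ℝ (Fin p))}
    {D2f : EuclideanSpace ℝ (Fin p) → Fin p → Fin p → (E →L[ℝ] ℝ)} {C : ℝ}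
    (hC : ∀ θ ∈ Θ, ∀ i j, ‖D2f θ i j‖ ≤ C) (ψ : (E →L[ℝ] ℝ) →L[ℝ] ℝ) :
    ∀ θ ∈ Θ, frob (fun i j => ψ (D2f θ i j)) ≤
      √(⨆ θ ∈ Θ, frob (fun i j => ψ (D2f θ i j)) ^ 2) :=
  frob_le_sqrt_biSup (M := fun θ i j => ψ (D2f θ i j)) (C := ‖ψ‖ * C)
    fun θ hθ i j => (ψ.le_opNorm _).trans (by gcongr; exact hC θ hθ i j)

end Taylor

section Discretization

variable {a b : ℝ} {F : (C(Set.Icc a b, ℝ) →L[ℝ] ℝ) → ℝ → ℝ} {t : ℕ → ℕ → Set.Icc a b} {n : ℕ}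

lemma gbump_apply (u : ℝ) (k : ℕ) (s : Set.Icc a b) :
    gbump a b u k s = max 0 (min 1 (1 - k * (s.1 - u))) := rfl

/-- The continuous approximation of the indicator function of the `i`-th partition cell. -/
def cellBump (t : ℕ → ℕ → Set.Icc a b) (n i k : ℕ) : C(Set.Icc a b, ℝ) :=
  if i = 1 then gbump a b (t n 1) k else gbump a b (t n i) k - gbump a b (t n (i - 1)) k

lemma tendsto_apply_cellBump
    (hF : ∀ (μ : C(Set.Icc a b, ℝ) →L[ℝ] ℝ) (u : ℝ),
      Tendsto (fun k : ℕ => μ (gbump a b u k)) atTop (𝓝 (F μ u)))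
    (μ : C(Set.Icc a b, ℝ) →L[ℝ] ℝ) (i : ℕ) :
    Tendsto (fun k => μ (cellBump t n i k)) atTop (𝓝 (coef F t n μ i)) := by
  unfold cellBump coef
  split_ifs
  · exact hF _ _
  · simpa using (hF μ _).sub (hF μ _)

lemma coef_add
    (hF : ∀ (μ : C(Set.Icc a b, ℝ) →L[ℝ] ℝ) (u : ℝ),
      Tendsto (fun k : ℕ => μ (gbump a b u k)) atTop (𝓝 (F μ u)))
    (μ ν : C(Set.Icc a b, ℝ) →L[ℝ] ℝ) (i : ℕ) :
    coef F t n (μ + ν) i = coef F t n μ i + coef F t n ν i :=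
  tendsto_nhds_unique (tendsto_apply_cellBump hF (μ + ν) i)
    (by simpa using (tendsto_apply_cellBump hF μ i).add (tendsto_apply_cellBump hF ν i))

lemma coef_smul
    (hF : ∀ (μ : C(Set.Icc a b, ℝ) →L[ℝ] ℝ) (u : ℝ),
      Tendsto (fun k : ℕ => μ (gbump a b u k)) atTop (𝓝 (F μ u)))
    (c : ℝ) (μ : C(Set.Icc a b, ℝ) →L[ℝ] ℝ) (i : ℕ) :
    coef F t n (c • μ) i = c * coef F t n μ i :=
  tendsto_nhds_unique (tendsto_apply_cellBump hF (c • μ) i)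
    (by simpa using (tendsto_apply_cellBump hF μ i).const_mul c)

lemma cellBump_nonneg (htmono : ∀ i < n, (t n i : ℝ) < (t n (i + 1) : ℝ))
    {i : ℕ} (hi : i ∈ Finset.Icc 1 n) (k : ℕ) (s : Set.Icc a b) : 0 ≤ cellBump t n i k s := by
  rw [Finset.mem_Icc] at hi
  unfold cellBump
  split_ifs with h
  · exact le_max_left _ _
  · have h1 := htmono (i - 1) (by omega)
    rw [Nat.sub_add_cancel hi.1] at h1
    rw [ContinuousMap.sub_apply, sub_nonneg, gbump_apply, gbump_apply]
    gcongr

lemma sum_cellBump (hn : 1 ≤ n) (htlast : (t n n : ℝ) = b) (k : ℕ) (s : Set.Icc a b) :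
    ∑ i ∈ Finset.Icc 1 n, cellBump t n i k s = 1 := by
  have h : ∀ m, 1 ≤ m → ∑ i ∈ Finset.Icc 1 m, cellBump t n i k s = gbump a b (t n m) k s := by
    intro m hm
    induction m, hm using Nat.le_induction with
    | base => simp [cellBump]
    | succ m hm ih =>
      rw [Finset.sum_Icc_succ_top (by omega), ih, cellBump, if_neg (by omega)]
      simp
  rw [h n hn, gbump_apply, htlast]
  have : (k : ℝ) * (s.1 - b) ≤ 0 :=
    mul_nonpos_of_nonneg_of_nonpos (by positivity) (by linarith [s.2.2])
  rw [min_eq_left (by linarith)]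
  simp

/-- The support of `cellBump t n i k` lies in the `1 / k`-neighbourhood of the `i`-th cell. -/
lemma exists_mem_TSet_of_cellBump_ne_zero (ht0 : (t n 0 : ℝ) = a)
    (htmono : ∀ i < n, (t n i : ℝ) < (t n (i + 1) : ℝ)) {i k : ℕ} (hi : i ∈ Finset.Icc 1 n)
    {s : Set.Icc a b} (hs : cellBump t n i k s ≠ 0) :
    ∃ s' : Set.Icc a b, (s' : ℝ) ∈ TSet t n i ∧ k * dist s s' ≤ 1 := by
  rw [Finset.mem_Icc] at hi
  have h1 := htmono (i - 1) (by omega)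
  rw [Nat.sub_add_cancel hi.1] at h1
  have hval : ((min s (t n i) : Set.Icc a b) : ℝ) = min (s : ℝ) (t n i) := by
    rcases le_total s (t n i) with h | h
    · rw [min_eq_left h, min_eq_left (by exact_mod_cast h)]
    · rw [min_eq_right h, min_eq_right (by exact_mod_cast h)]
  have hk0 : (0 : ℝ) ≤ k := by positivity
  refine ⟨min s (t n i), ?_, ?_⟩
  · rw [hval]
    unfold TSet
    split_ifs with h
    · subst h
      exact ⟨by rw [ht0]; exact le_min s.2.1 (t n 1).2.1, min_le_right _ _⟩
    · refine ⟨lt_min ?_ h1, min_le_right _ _⟩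
      by_contra! hle
      apply hs
      have e1 : (k : ℝ) * (s.1 - t n i) ≤ 0 :=
        mul_nonpos_of_nonneg_of_nonpos hk0 (by linarith)
      have e2 : (k : ℝ) * (s.1 - t n (i - 1)) ≤ 0 :=
        mul_nonpos_of_nonneg_of_nonpos hk0 (by linarith)
      rw [cellBump, if_neg h, ContinuousMap.sub_apply, gbump_apply, gbump_apply,
        min_eq_left (by linarith), min_eq_left (by linarith), sub_self]
  · rw [Subtype.dist_eq, hval, Real.dist_eq]
    rcases le_total (s : ℝ) (t n i) with h | h
    · simp [min_eq_left h]
    · rw [min_eq_right h, abs_of_nonneg (by linarith)]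
      by_contra! hgt
      apply hs
      have e2 : (k : ℝ) * (s.1 - t n i) ≤ k * (s.1 - t n (i - 1)) := by gcongr
      have e3 : gbump a b (t n i) k s = 0 := by
        rw [gbump_apply, max_eq_left]
        exact (min_le_right _ _).trans (by linarith)
      have e4 : gbump a b (t n (i - 1)) k s = 0 := by
        rw [gbump_apply, max_eq_left]
        exact (min_le_right _ _).trans (by linarith)
      unfold cellBump
      split_ifs with h'
      · subst h'; exact e3
      · rw [ContinuousMap.sub_apply, e3, e4, sub_self]

/-- If the step function with values `y i` on the cells is `η`-close to `x`, then its integral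
against `μ` is `‖μ‖ * η`-close to that of `x`. -/
lemma abs_sum_coef_mul_sub_apply_le
    (hF : ∀ (μ : C(Set.Icc a b, ℝ) →L[ℝ] ℝ) (u : ℝ),
      Tendsto (fun k : ℕ => μ (gbump a b u k)) atTop (𝓝 (F μ u)))
    (hn : 1 ≤ n) (ht0 : (t n 0 : ℝ) = a) (htlast : (t n n : ℝ) = b)
    (htmono : ∀ i < n, (t n i : ℝ) < (t n (i + 1) : ℝ))
    (μ : C(Set.Icc a b, ℝ) →L[ℝ] ℝ) (x : C(Set.Icc a b, ℝ)) (y : ℕ → ℝ) {η : ℝ} (hη : 0 ≤ η)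
    (h : ∀ i ∈ Finset.Icc 1 n, ∀ s : Set.Icc a b, (s : ℝ) ∈ TSet t n i → |y i - x s| ≤ η) :
    |∑ i ∈ Finset.Icc 1 n, coef F t n μ i * y i - μ x| ≤ ‖μ‖ * η := by
  have key : ∀ e > (0 : ℝ),
      |∑ i ∈ Finset.Icc 1 n, coef F t n μ i * y i - μ x| ≤ ‖μ‖ * (η + e) := by
    intro e he
    obtain ⟨δ, hδ, hxδ⟩ := Metric.uniformContinuous_iff.1
      (CompactSpace.uniformContinuous_of_continuous x.continuous) e he
    have hlim : Tendsto (fun k => |∑ i ∈ Finset.Icc 1 n, μ (cellBump t n i k) * y i - μ x|) atTop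
        (𝓝 |∑ i ∈ Finset.Icc 1 n, coef F t n μ i * y i - μ x|) :=
      ((tendsto_finsetSum _ fun i _ =>
        (tendsto_apply_cellBump hF μ i).mul_const (y i)).sub_const _).abs
    refine le_of_tendsto hlim ?_
    obtain ⟨k₀, hk₀⟩ := exists_nat_gt δ⁻¹
    filter_upwards [eventually_ge_atTop k₀] with k hk
    have hkδ : δ⁻¹ < k := hk₀.trans_le (by exact_mod_cast hk)
    have hsum : ∑ i ∈ Finset.Icc 1 n, μ (cellBump t n i k) * y i - μ x =
        μ (∑ i ∈ Finset.Icc 1 n, y i • cellBump t n i k - x) := by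
      simp [map_sub, map_sum, mul_comm]
    rw [hsum]
    refine (μ.le_opNorm _).trans ?_
    gcongr
    rw [ContinuousMap.norm_le _ (by positivity)]
    intro s
    have hs : (∑ i ∈ Finset.Icc 1 n, y i • cellBump t n i k - x) s =
        ∑ i ∈ Finset.Icc 1 n, cellBump t n i k s * (y i - x s) := by
      simp only [mul_sub, Finset.sum_sub_distrib, ← Finset.sum_mul, sum_cellBump hn htlast k s]
      simp [mul_comm]
    rw [hs]
    calc ‖∑ i ∈ Finset.Icc 1 n, cellBump t n i k s * (y i - x s)‖
        ≤ ∑ i ∈ Finset.Icc 1 n, cellBump t n i k s * (η + e) := by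
          refine (norm_sum_le _ _).trans (Finset.sum_le_sum fun i hi => ?_)
          rw [norm_mul, Real.norm_of_nonneg (cellBump_nonneg htmono hi k s)]
          rcases eq_or_ne (cellBump t n i k s) 0 with h0 | h0
          · simp [h0]
          obtain ⟨s', hs', hd⟩ := exists_mem_TSet_of_cellBump_ne_zero ht0 htmono hi h0
          refine mul_le_mul_of_nonneg_left ?_ (cellBump_nonneg htmono hi k s)
          have hlt : dist s s' < δ := by
            by_contra! hge
            have : 1 < (k : ℝ) * δ := by
              rwa [inv_lt_iff_one_lt_mul₀ hδ] at hkδ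
            have : (k : ℝ) * δ ≤ k * dist s s' := by gcongr
            linarith
          have h2 := hxδ hlt
          rw [dist_comm, Real.dist_eq] at h2
          have e3 : y i - x s = (y i - x s') + (x s' - x s) := by ring
          rw [e3]
          exact (norm_add_le _ _).trans (add_le_add (h i hi s' hs') h2.le)
      _ = η + e := by rw [← Finset.sum_mul, sum_cellBump hn htlast k s, one_mul]
  have hlim : Tendsto (fun e : ℝ => ‖μ‖ * (η + e)) (𝓝[>] 0) (𝓝 (‖μ‖ * η)) := by
    have : Tendsto (fun e : ℝ => ‖μ‖ * (η + e)) (𝓝 0) (𝓝 (‖μ‖ * (η + 0))) :=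
      Continuous.tendsto (by fun_prop) 0
    rw [add_zero] at this
    exact this.mono_left nhdsWithin_le_nhds
  exact ge_of_tendsto hlim (by filter_upwards [self_mem_nhdsWithin] with e he using key e he)

lemma muDisc_apply (μ : C(Set.Icc a b, ℝ) →L[ℝ] ℝ) (x : C(Set.Icc a b, ℝ)) :
    muDisc F t n μ x = ∑ i ∈ Finset.Icc 1 n, coef F t n μ i * x (t n i) := by
  simp [muDisc, dirac]

lemma abs_muDisc_apply_le
    (hF : ∀ (μ : C(Set.Icc a b, ℝ) →L[ℝ] ℝ) (u : ℝ),
      Tendsto (fun k : ℕ => μ (gbump a b u k)) atTop (𝓝 (F μ u)))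
    (hn : 1 ≤ n) (ht0 : (t n 0 : ℝ) = a) (htlast : (t n n : ℝ) = b)
    (htmono : ∀ i < n, (t n i : ℝ) < (t n (i + 1) : ℝ))
    (μ : C(Set.Icc a b, ℝ) →L[ℝ] ℝ) (x : C(Set.Icc a b, ℝ)) :
    |muDisc F t n μ x| ≤ ‖μ‖ * ‖x‖ := by
  have h := abs_sum_coef_mul_sub_apply_le hF hn ht0 htlast htmono μ 0 (fun i => x (t n i))
    (norm_nonneg x) (fun i _ s _ => by simpa using x.norm_coe_le_norm (t n i))
  simpa [muDisc_apply] using h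

/-- The discretization error `μ ↦ ⟨μⁿ - μ, z⟩` as a continuous linear functional. -/
lemma exists_clm_muDisc_sub
    (hF : ∀ (μ : C(Set.Icc a b, ℝ) →L[ℝ] ℝ) (u : ℝ),
      Tendsto (fun k : ℕ => μ (gbump a b u k)) atTop (𝓝 (F μ u)))
    (hn : 1 ≤ n) (ht0 : (t n 0 : ℝ) = a) (htlast : (t n n : ℝ) = b)
    (htmono : ∀ i < n, (t n i : ℝ) < (t n (i + 1) : ℝ)) (z : C(Set.Icc a b, ℝ)) :
    ∃ ψ : (C(Set.Icc a b, ℝ) →L[ℝ] ℝ) →L[ℝ] ℝ, ∀ μ, ψ μ = (muDisc F t n μ - μ) z := by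
  refine ⟨LinearMap.mkContinuous
    { toFun := fun μ => (muDisc F t n μ - μ) z
      map_add' := fun μ ν => ?_
      map_smul' := fun c μ => ?_ } (2 * ‖z‖) fun μ => ?_, fun μ => rfl⟩
  · simp only [_root_.sub_apply, _root_.add_apply, muDisc_apply,
      coef_add hF, add_mul, Finset.sum_add_distrib]
    ring
  · simp only [_root_.sub_apply, _root_.smul_apply, muDisc_apply,
      coef_smul hF, mul_assoc, ← Finset.mul_sum, smul_eq_mul, RingHom.id_apply]
    ring
  · have h1 := abs_muDisc_apply_le hF hn ht0 htlast htmono μ z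
    have h2 := μ.le_opNorm z
    refine (norm_sub_le (muDisc F t n μ z) (μ z)).trans ?_
    rw [Real.norm_eq_abs]
    linarith

lemma exists_mem_TSet (hn : 1 ≤ n) (ht0 : (t n 0 : ℝ) = a) (htlast : (t n n : ℝ) = b)
    (s : Set.Icc a b) : ∃ i, 1 ≤ i ∧ i ≤ n ∧ (s : ℝ) ∈ TSet t n i := by
  classical
  have hex : ∃ i, 1 ≤ i ∧ (s : ℝ) ≤ t n i := ⟨n, hn, by rw [htlast]; exact s.2.2⟩
  refine ⟨Nat.find hex, (Nat.find_spec hex).1,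
    Nat.find_min' hex ⟨hn, by rw [htlast]; exact s.2.2⟩, ?_⟩
  have hspec := Nat.find_spec hex
  have hmin := fun {m} => Nat.find_min hex (m := m)
  generalize Nat.find hex = i at hspec hmin
  unfold TSet
  split_ifs with h
  · subst h
    exact ⟨by rw [ht0]; exact s.2.1, hspec.2⟩
  · refine ⟨?_, hspec.2⟩
    have := hmin (m := i - 1) (by omega)
    by_contra! hle
    exact this ⟨by omega, hle⟩

lemma partition_point_mem_TSet (htmono : ∀ i < n, (t n i : ℝ) < (t n (i + 1) : ℝ)) {i : ℕ}
    (hi : i ∈ Finset.Icc 1 n) : (t n i : ℝ) ∈ TSet t n i := by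
  rw [Finset.mem_Icc] at hi
  have h1 := htmono (i - 1) (by omega)
  rw [Nat.sub_add_cancel hi.1] at h1
  unfold TSet
  split_ifs with h
  · subst h
    exact ⟨h1.le, le_rfl⟩
  · exact ⟨h1, le_rfl⟩

lemma KnDiff_nonneg (K : C(Set.Icc a b × Set.Icc a b, ℝ))
    (Kn : ℕ → Set.Icc a b → Set.Icc a b → ℝ) (n : ℕ) : 0 ≤ KnDiff K Kn n :=
  Real.iSup_nonneg fun _ => abs_nonneg _

lemma abs_sub_le_KnDiff {K : C(Set.Icc a b × Set.Icc a b, ℝ)}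
    {Kn : ℕ → Set.Icc a b → Set.Icc a b → ℝ}
    (hn : 1 ≤ n) (ht0 : (t n 0 : ℝ) = a) (htlast : (t n n : ℝ) = b)
    (hKn : ∀ i j, 1 ≤ i → i ≤ n → 1 ≤ j → j ≤ n → ∀ s u : Set.Icc a b,
      (s : ℝ) ∈ TSet t n i → (u : ℝ) ∈ TSet t n j → Kn n s u = K (t n i, t n j))
    {i j : ℕ} (hi : i ∈ Finset.Icc 1 n) (hj : j ∈ Finset.Icc 1 n) {s u : Set.Icc a b}
    (hs : (s : ℝ) ∈ TSet t n i) (hu : (u : ℝ) ∈ TSet t n j) :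
    |K (t n i, t n j) - K (s, u)| ≤ KnDiff K Kn n := by
  rw [Finset.mem_Icc] at hi hj
  have hb : ∀ su : Set.Icc a b × Set.Icc a b, |(|Kn n su.1 su.2 - K su|)| ≤ ‖K‖ + ‖K‖ := by
    rintro ⟨s, u⟩
    obtain ⟨i, hi1, hin, hsi⟩ := exists_mem_TSet hn ht0 htlast s
    obtain ⟨j, hj1, hjn, huj⟩ := exists_mem_TSet hn ht0 htlast u
    rw [abs_abs, hKn i j hi1 hin hj1 hjn s u hsi huj]
    exact (norm_sub_le _ _).trans (add_le_add (K.norm_coe_le_norm _) (K.norm_coe_le_norm _))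
  rw [← hKn i j hi.1 hi.2 hj.1 hj.2 s u hs hu]
  exact le_ciSup (bddAbove_range_of_abs_le hb) (s, u)

/-- The discretized energy form `∑ᵢⱼ μ(Tᵢ) ν(Tⱼ) K(tᵢ,tⱼ)`. -/
def energyD (F : (C(Set.Icc a b, ℝ) →L[ℝ] ℝ) → ℝ → ℝ) (t : ℕ → ℕ → Set.Icc a b)
    (K : C(Set.Icc a b × Set.Icc a b, ℝ)) (n : ℕ) (μ ν : C(Set.Icc a b, ℝ) →L[ℝ] ℝ) : ℝ :=
  ∑ i ∈ Finset.Icc 1 n, coef F t n μ i * ∑ j ∈ Finset.Icc 1 n, coef F t n ν j * K (t n i, t n j)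

lemma contrastD_eq (K : C(Set.Icc a b × Set.Icc a b, ℝ)) (μ : C(Set.Icc a b, ℝ) →L[ℝ] ℝ)
    (x : C(Set.Icc a b, ℝ)) :
    contrastD F t K n μ x = muDisc F t n μ x - 1 / 2 * energyD F t K n μ μ := by
  simp only [contrastD, muDisc_apply, energyD, Finset.mul_sum, mul_assoc]

lemma energyD_comm {K : C(Set.Icc a b × Set.Icc a b, ℝ)}
    (hKsymm : ∀ s t : Set.Icc a b, K (s, t) = K (t, s)) (μ ν : C(Set.Icc a b, ℝ) →L[ℝ] ℝ) :
    energyD F t K n μ ν = energyD F t K n ν μ := by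
  simp only [energyD, Finset.mul_sum]
  rw [Finset.sum_comm]
  refine Finset.sum_congr rfl fun i _ => Finset.sum_congr rfl fun j _ => ?_
  rw [hKsymm]
  ring

lemma energyD_add_left
    (hF : ∀ (μ : C(Set.Icc a b, ℝ) →L[ℝ] ℝ) (u : ℝ),
      Tendsto (fun k : ℕ => μ (gbump a b u k)) atTop (𝓝 (F μ u)))
    (K : C(Set.Icc a b × Set.Icc a b, ℝ)) (μ μ' ν : C(Set.Icc a b, ℝ) →L[ℝ] ℝ) :
    energyD F t K n (μ + μ') ν = energyD F t K n μ ν + energyD F t K n μ' ν := by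
  simp only [energyD, coef_add hF, add_mul, Finset.sum_add_distrib]

lemma abs_sum_coef_mul_kernel_sub_le
    (hF : ∀ (μ : C(Set.Icc a b, ℝ) →L[ℝ] ℝ) (u : ℝ),
      Tendsto (fun k : ℕ => μ (gbump a b u k)) atTop (𝓝 (F μ u)))
    {K : C(Set.Icc a b × Set.Icc a b, ℝ)}
    {Kop : (C(Set.Icc a b, ℝ) →L[ℝ] ℝ) →L[ℝ] C(Set.Icc a b, ℝ)}
    (hKop : ∀ (μ : C(Set.Icc a b, ℝ) →L[ℝ] ℝ) (s : Set.Icc a b), Kop μ s = μ (K.curry s))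
    {Kn : ℕ → Set.Icc a b → Set.Icc a b → ℝ}
    (hn : 1 ≤ n) (ht0 : (t n 0 : ℝ) = a) (htlast : (t n n : ℝ) = b)
    (htmono : ∀ i < n, (t n i : ℝ) < (t n (i + 1) : ℝ))
    (hKn : ∀ i j, 1 ≤ i → i ≤ n → 1 ≤ j → j ≤ n → ∀ s u : Set.Icc a b,
      (s : ℝ) ∈ TSet t n i → (u : ℝ) ∈ TSet t n j → Kn n s u = K (t n i, t n j))
    (ν : C(Set.Icc a b, ℝ) →L[ℝ] ℝ) {i : ℕ} (hi : i ∈ Finset.Icc 1 n) {s : Set.Icc a b}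
    (hs : (s : ℝ) ∈ TSet t n i) :
    |∑ j ∈ Finset.Icc 1 n, coef F t n ν j * K (t n i, t n j) - Kop ν s| ≤
      ‖ν‖ * KnDiff K Kn n := by
  rw [hKop]
  exact abs_sum_coef_mul_sub_apply_le hF hn ht0 htlast htmono ν (K.curry s)
    (fun j => K (t n i, t n j)) (KnDiff_nonneg K Kn n) fun j hj u hu =>
      abs_sub_le_KnDiff hn ht0 htlast hKn hi hj hs hu

/-- Basic inequality: a measure with a larger discrete contrast than `μ₀` has small energy
distance to `μ₀`, up to noise and discretization errors. -/
lemma energy_le_of_contrastD_le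
    (hF : ∀ (μ : C(Set.Icc a b, ℝ) →L[ℝ] ℝ) (u : ℝ),
      Tendsto (fun k : ℕ => μ (gbump a b u k)) atTop (𝓝 (F μ u)))
    {K : C(Set.Icc a b × Set.Icc a b, ℝ)}
    (hKsymm : ∀ s t : Set.Icc a b, K (s, t) = K (t, s))
    {Kop : (C(Set.Icc a b, ℝ) →L[ℝ] ℝ) →L[ℝ] C(Set.Icc a b, ℝ)}
    (hKop : ∀ (μ : C(Set.Icc a b, ℝ) →L[ℝ] ℝ) (s : Set.Icc a b), Kop μ s = μ (K.curry s))
    {Kn : ℕ → Set.Icc a b → Set.Icc a b → ℝ}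
    (hn : 1 ≤ n) (ht0 : (t n 0 : ℝ) = a) (htlast : (t n n : ℝ) = b)
    (htmono : ∀ i < n, (t n i : ℝ) < (t n (i + 1) : ℝ))
    (hKn : ∀ i j, 1 ≤ i → i ≤ n → 1 ≤ j → j ≤ n → ∀ s u : Set.Icc a b,
      (s : ℝ) ∈ TSet t n i → (u : ℝ) ∈ TSet t n j → Kn n s u = K (t n i, t n j))
    {μ₀ μ : C(Set.Icc a b, ℝ) →L[ℝ] ℝ} {z : C(Set.Icc a b, ℝ)}
    (hle : contrastD F t K n μ₀ (Kop μ₀ + z) ≤ contrastD F t K n μ (Kop μ₀ + z)) :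
    1 / 2 * (μ - μ₀) (Kop (μ - μ₀)) ≤ muDisc F t n (μ - μ₀) z +
      KnDiff K Kn n * ‖μ - μ₀‖ * (‖μ₀‖ + 1 / 2 * ‖μ - μ₀‖) := by
  have hKD := KnDiff_nonneg K Kn n
  set δ := μ - μ₀ with hδ
  have hμ : μ = μ₀ + δ := by rw [hδ]; abel
  have hadd : ∀ x, muDisc F t n (μ₀ + δ) x = muDisc F t n μ₀ x + muDisc F t n δ x := by
    intro x
    simp only [muDisc_apply, coef_add hF, add_mul, Finset.sum_add_distrib]
  rw [contrastD_eq, contrastD_eq, hμ, hadd, energyD_add_left hF, energyD_comm hKsymm μ₀ (μ₀ + δ),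
    energyD_comm hKsymm δ (μ₀ + δ), energyD_add_left hF, energyD_add_left hF,
    energyD_comm hKsymm μ₀ δ, map_add, map_add] at hle
  have hrow := fun ν i hi s hs => abs_sum_coef_mul_kernel_sub_le hF hKop hn ht0 htlast htmono hKn
    ν (i := i) hi (s := s) hs
  have h1 : |energyD F t K n δ δ - δ (Kop δ)| ≤ ‖δ‖ * (‖δ‖ * KnDiff K Kn n) :=
    abs_sum_coef_mul_sub_apply_le hF hn ht0 htlast htmono δ (Kop δ)
      (fun i => ∑ j ∈ Finset.Icc 1 n, coef F t n δ j * K (t n i, t n j)) (by positivity)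
      (hrow δ)
  have h2 : |energyD F t K n δ μ₀ - muDisc F t n δ (Kop μ₀)| ≤
      ‖δ‖ * (‖μ₀‖ * KnDiff K Kn n) := by
    have := abs_sum_coef_mul_sub_apply_le hF hn ht0 htlast htmono δ 0
      (fun i => ∑ j ∈ Finset.Icc 1 n, coef F t n μ₀ j * K (t n i, t n j) - Kop μ₀ (t n i))
      (η := ‖μ₀‖ * KnDiff K Kn n) (by positivity) (fun i hi s _ => by
        simpa using hrow μ₀ i hi (t n i) (partition_point_mem_TSet htmono hi))
    simpa only [mul_sub, Finset.sum_sub_distrib, map_zero, sub_zero, muDisc_apply, energyD]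
      using this
  have h1' := neg_le_of_abs_le h1
  have h2' := neg_le_of_abs_le h2
  linarith

end Discretization

/-- Resolution of the basic inequality into a bound on the energy. -/
lemma mul_energy_le_of_basic_inequality {c M E x ε κ A₁ A₂ S₁ S₂ : ℝ} (hc : 0 < c) (hM : 0 < M)
    (hE : 0 ≤ E) (hx : 0 ≤ x) (hε : 0 < ε) (hκ : 0 ≤ κ) (hA₁ : 0 ≤ A₁) (hA₂ : 0 ≤ A₂)
    (hS₁ : 0 ≤ S₁) (hS₂ : 0 ≤ S₂) (hcE : c * x ^ 2 ≤ E)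
    (h : E ≤ M * x * (ε * (√A₁ + √S₁ + √A₂ + √S₂) + κ)) :
    c / (5 * M ^ 2) / ε ^ 2 * E ≤ (ε ^ 2)⁻¹ * κ ^ 2 + A₁ + S₁ + A₂ + S₂ := by
  set R := ε * (√A₁ + √S₁ + √A₂ + √S₂) + κ with hR
  have hR0 : 0 ≤ R := by positivity
  have hEc : c * E ≤ M ^ 2 * R ^ 2 := by
    rcases hE.eq_or_lt with h0 | hpos
    · rw [← h0]; simp; positivity
    refine le_of_mul_le_mul_right ?_ hpos
    calc c * E * E ≤ c * ((M * x * R) * (M * x * R)) := by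
          rw [mul_assoc]; gcongr
      _ = (M ^ 2 * R ^ 2) * (c * x ^ 2) := by ring
      _ ≤ (M ^ 2 * R ^ 2) * E := by gcongr
  have hR2 : R ^ 2 ≤ 5 * (ε ^ 2 * (A₁ + S₁ + A₂ + S₂) + κ ^ 2) := by
    have h5 : ∀ p q r s u : ℝ,
        (p + q + r + s + u) ^ 2 ≤ 5 * (p ^ 2 + q ^ 2 + r ^ 2 + s ^ 2 + u ^ 2) := by
      intro p q r s u
      nlinarith [sq_nonneg (p - q), sq_nonneg (p - r), sq_nonneg (p - s), sq_nonneg (p - u),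
        sq_nonneg (q - r), sq_nonneg (q - s), sq_nonneg (q - u), sq_nonneg (r - s),
        sq_nonneg (r - u), sq_nonneg (s - u)]
    have := h5 (ε * √A₁) (ε * √S₁) (ε * √A₂) (ε * √S₂) κ
    simp only [mul_pow, Real.sq_sqrt hA₁, Real.sq_sqrt hA₂, Real.sq_sqrt hS₁,
      Real.sq_sqrt hS₂] at this
    rw [hR]
    linarith
  have hfin : c * E ≤ 5 * M ^ 2 * (ε ^ 2 * (A₁ + S₁ + A₂ + S₂) + κ ^ 2) := by
    have := mul_le_mul_of_nonneg_left hR2 (sq_nonneg M)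
    linarith
  calc c / (5 * M ^ 2) / ε ^ 2 * E = (c * E) / (5 * M ^ 2 * ε ^ 2) := by field_simp
    _ ≤ (5 * M ^ 2 * (ε ^ 2 * (A₁ + S₁ + A₂ + S₂) + κ ^ 2)) / (5 * M ^ 2 * ε ^ 2) := by gcongr
    _ = _ := by field_simp; ring

/-- Proposition 3.26, energy upper bound.
There is a constant `c₁ > 0` (depending only on `𝒦`, `θ₀`, `(μ_θ)` and `Θ`) such that,
almost surely,
`(c₁/ε²)⟨μ_{θ̂} − μ_{θ₀}, 𝒦(μ_{θ̂} − μ_{θ₀})⟩ ≤ ε⁻²‖Kⁿ−K‖²_{L∞} + |⟨∇μ_{θ₀},Z⟩|²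
 + sup_Θ ‖⟨∇²μ_θ,Z⟩‖_F² + |⟨∇(μⁿ−μ)_{θ₀},Z⟩|² + sup_Θ ‖⟨∇²(μⁿ−μ)_θ,Z⟩‖_F²`. -/
theorem stmt14 {a b : ℝ} (hab : a < b) {p : ℕ}
    {Ω : Type*} [MeasurableSpace Ω] (P : Measure Ω) [IsProbabilityMeasure P]
    (K : C(Set.Icc a b × Set.Icc a b, ℝ))
    (hKsymm : ∀ s t : Set.Icc a b, K (s, t) = K (t, s))
    (Kop : (C(Set.Icc a b, ℝ) →L[ℝ] ℝ) →L[ℝ] C(Set.Icc a b, ℝ))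
    (hKop : ∀ (μ : C(Set.Icc a b, ℝ) →L[ℝ] ℝ) (s : Set.Icc a b), Kop μ s = μ (K.curry s))
    (hpos : ∀ μ : C(Set.Icc a b, ℝ) →L[ℝ] ℝ, 0 ≤ μ (Kop μ))
    (hsym : ∀ μ ν : C(Set.Icc a b, ℝ) →L[ℝ] ℝ, μ (Kop ν) = ν (Kop μ))
    (Z : Ω → C(Set.Icc a b, ℝ))
    (hZmeas : ∀ ν : C(Set.Icc a b, ℝ) →L[ℝ] ℝ, Measurable fun ω => ν (Z ω))
    (hZgauss : ∀ ν : C(Set.Icc a b, ℝ) →L[ℝ] ℝ,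
      P.map (fun ω => ν (Z ω)) = gaussianReal 0 (Real.toNNReal (ν (Kop ν))))
    (hZcov : ∀ μ ν : C(Set.Icc a b, ℝ) →L[ℝ] ℝ,
      ∫ ω, μ (Z ω) * ν (Z ω) ∂P = μ (Kop ν))
    (Θ : Set (EuclideanSpace ℝ (Fin p))) (hΘc : IsCompact Θ) (hΘconv : Convex ℝ Θ)
    (θ₀ : EuclideanSpace ℝ (Fin p)) (hθ₀Θ : θ₀ ∈ Θ) (hθ₀ : θ₀ ∈ interior Θ)
    (μf : EuclideanSpace ℝ (Fin p) → (C(Set.Icc a b, ℝ) →L[ℝ] ℝ))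
    (hcont : ContinuousOn μf Θ)
    (hident : ∀ θ ∈ Θ, (∀ s : Set.Icc a b, Kop (μf θ) s = Kop (μf θ₀) s) → θ = θ₀)
    (Dμ : EuclideanSpace ℝ (Fin p) → Fin p → (C(Set.Icc a b, ℝ) →L[ℝ] ℝ))
    (D2μ : EuclideanSpace ℝ (Fin p) → Fin p → Fin p → (C(Set.Icc a b, ℝ) →L[ℝ] ℝ))
    (hD1 : ∀ θ ∈ Θ, HasFDerivWithinAt μf (clmOfPartials (Dμ θ)) Θ θ)
    (hD2 : ∀ θ ∈ Θ, ∀ i, HasFDerivWithinAt (fun θ' => Dμ θ' i)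
      (clmOfPartials (fun j => D2μ θ j i)) Θ θ)
    (hD2cont : UniformContinuousOn D2μ Θ)
    (Sig : Matrix (Fin p) (Fin p) ℝ)
    (hSigdef : ∀ i j, Sig i j = (Dμ θ₀ i) (Kop (Dμ θ₀ j)))
    (hSiginv : IsUnit Sig.det)
    -- the partitions `0 = t n 0 < t n 1 < ⋯ < t n n = max T` with vanishing mesh
    (t : ℕ → ℕ → Set.Icc a b)
    (ht0 : ∀ n, 1 ≤ n → (t n 0 : ℝ) = a)
    (htlast : ∀ n, 1 ≤ n → (t n n : ℝ) = b)
    (htmono : ∀ n, 1 ≤ n → ∀ i < n, (t n i : ℝ) < (t n (i + 1) : ℝ))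
    (hmesh : ∀ δ > (0 : ℝ), ∃ N, ∀ n ≥ N, ∀ i < n, (t n (i + 1) : ℝ) - (t n i : ℝ) < δ)
    -- `F μ u = μ([a,u])`, the cumulative distribution function of `μ`
    (F : (C(Set.Icc a b, ℝ) →L[ℝ] ℝ) → ℝ → ℝ)
    (hF : ∀ (μ : C(Set.Icc a b, ℝ) →L[ℝ] ℝ) (u : ℝ),
      Tendsto (fun k : ℕ => μ (gbump a b u k)) atTop (𝓝 (F μ u)))
    -- the discretized covariance function `Kⁿ`
    (Kn : ℕ → Set.Icc a b → Set.Icc a b → ℝ)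
    (hKn : ∀ n, 1 ≤ n → ∀ i j, 1 ≤ i → i ≤ n → 1 ≤ j → j ≤ n → ∀ s u : Set.Icc a b,
      (s : ℝ) ∈ TSet t n i → (u : ℝ) ∈ TSet t n j → Kn n s u = K (t n i, t n j))
    -- the discrete M-estimator
    (θhat : ℕ → ℝ → Ω → EuclideanSpace ℝ (Fin p))
    (hθmeas : ∀ n ε, Measurable (θhat n ε))
    (hmem : ∀ n, 1 ≤ n → ∀ ε > (0 : ℝ), ∀ ω, θhat n ε ω ∈ Θ)
    (hargmax : ∀ n, 1 ≤ n → ∀ ε > (0 : ℝ), ∀ ω, ∀ θ ∈ Θ,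
      contrastD F t K n (μf θ) (Kop (μf θ₀) + ε • Z ω) ≤
        contrastD F t K n (μf (θhat n ε ω)) (Kop (μf θ₀) + ε • Z ω)) :
    ∃ c₁ > (0 : ℝ), ∀ n, 1 ≤ n → ∀ ε > (0 : ℝ),
      ∀ᵐ ω ∂P,
        c₁ / ε ^ 2 *
            ((μf (θhat n ε ω) - μf θ₀) (Kop (μf (θhat n ε ω) - μf θ₀))) ≤
          (ε ^ 2)⁻¹ * KnDiff K Kn n ^ 2 +
            (∑ i, ((Dμ θ₀ i) (Z ω)) ^ 2) +
              (⨆ θ ∈ Θ, (frob fun i j => (D2μ θ i j) (Z ω)) ^ 2) +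
                (∑ i, ((muDisc F t n (Dμ θ₀ i) - Dμ θ₀ i) (Z ω)) ^ 2) +
                  ⨆ θ ∈ Θ, (frob fun i j => (muDisc F t n (D2μ θ i j) - D2μ θ i j) (Z ω)) ^ 2 := by
  have hpartials : ∀ x, clmOfPartials (Dμ θ₀) x = ∑ i, x i • Dμ θ₀ i :=
    partialsCLM_apply (Dμ θ₀)
  have hdeg : ∀ x, clmOfPartials (Dμ θ₀) x (Kop (clmOfPartials (Dμ θ₀) x)) = 0 → x = 0 := by
    intro x hx
    have hrad := apply_eq_zero_of_isotropic Kop hpos hsym hx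
    have hmul : Sig *ᵥ x.ofLp = 0 := by
      ext i
      have := hrad (Dμ θ₀ i)
      rw [hpartials] at this
      simpa [Matrix.mulVec, dotProduct, hSigdef, mul_comm] using this
    have hinj := Matrix.mulVec_injective_of_isUnit ((Matrix.isUnit_iff_isUnit_det Sig).2 hSiginv)
    have h0 : x.ofLp = 0 := hinj (by rw [hmul, Matrix.mulVec_zero])
    ext i
    simpa using congrFun h0 i
  obtain ⟨c, hc, hcE⟩ := exists_pos_mul_sq_le_energy
    (E := C(Set.Icc a b, ℝ)) Kop hpos hsym hΘc hθ₀Θ hcont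
    (hD1 θ₀ hθ₀Θ) hdeg fun θ hθ h => hident θ hθ fun s => by
      have h1 := apply_eq_zero_of_isotropic Kop hpos hsym h (dirac s)
      have h2 : Kop (μf θ - μf θ₀) s = 0 := h1
      rw [map_sub, ContinuousMap.sub_apply] at h2
      linarith
  obtain ⟨C₁, hC₁0, hlip⟩ := exists_norm_sub_le_mul_norm_sub
    (E := C(Set.Icc a b, ℝ)) hΘc hΘconv hθ₀Θ hD1 hD2
  obtain ⟨C₂, hD2norm⟩ := exists_norm_le_of_continuousOn
    (E := C(Set.Icc a b, ℝ)) hΘc hD2cont.continuousOn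
  obtain ⟨d, hd⟩ := hΘc.exists_bound_of_continuousOn
    (f := fun θ => θ - θ₀) (by fun_prop)
  have hd0 : 0 ≤ d := (norm_nonneg _).trans (hd θ₀ hθ₀Θ)
  set M : ℝ := 2 * (1 + d + C₁ * (‖μf θ₀‖ + C₁ * d)) with hM
  have hMpos : 0 < M := by positivity
  refine ⟨c / (5 * M ^ 2), by positivity, fun n hn ε hε => Eventually.of_forall fun ω => ?_⟩
  set θ := θhat n ε ω with hθdef
  have hθ : θ ∈ Θ := hmem n hn ε hε ω
  obtain ⟨ψ, hψ⟩ := exists_clm_muDisc_sub hF hn (ht0 n hn) (htlast n hn) (htmono n hn) (Z ω)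
  have hS₁ := frob_apply_le_sqrt_biSup (E := C(Set.Icc a b, ℝ)) hD2norm
    (ContinuousLinearMap.apply ℝ ℝ (Z ω))
  have hS₂ := frob_apply_le_sqrt_biSup (E := C(Set.Icc a b, ℝ)) hD2norm ψ
  have hT₁ := abs_apply_sub_le_taylor (E := C(Set.Icc a b, ℝ)) hΘconv hθ₀Θ hθ hD1 hD2
    (ContinuousLinearMap.apply ℝ ℝ (Z ω)) hS₁
  have hT₂ := abs_apply_sub_le_taylor (E := C(Set.Icc a b, ℝ)) hΘconv hθ₀Θ hθ hD1 hD2 ψ hS₂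
  have hbasic := energy_le_of_contrastD_le hF hKsymm hKop hn (ht0 n hn) (htlast n hn)
    (htmono n hn) (hKn n hn) (hargmax n hn ε hε ω θ₀ hθ₀Θ)
  simp only [← hψ]
  have hdisc : muDisc F t n (μf θ - μf θ₀) (ε • Z ω) =
      ε * ((μf θ - μf θ₀) (Z ω) + ψ (μf θ - μf θ₀)) := by
    rw [hψ, map_smul, _root_.sub_apply (muDisc F t n (μf θ - μf θ₀)), smul_eq_mul]
    ring
  rw [← hθdef, hdisc] at hbasic
  simp only [ContinuousLinearMap.apply_apply] at hT₁
  have hκ := KnDiff_nonneg K Kn n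
  have hx := hlip θ hθ
  have hxd : ‖θ - θ₀‖ ≤ d := hd θ hθ
  refine mul_energy_le_of_basic_inequality hc hMpos (hpos _) (norm_nonneg (θ - θ₀)) hε hκ
    (by positivity) (by positivity)
    (Real.iSup_nonneg fun _ => Real.iSup_nonneg fun _ => sq_nonneg _)
    (Real.iSup_nonneg fun _ => Real.iSup_nonneg fun _ => sq_nonneg _) (hcE θ hθ) ?_
  set x := ‖θ - θ₀‖
  set κ := KnDiff K Kn n
  set A₁ := √(∑ i, (Dμ θ₀ i (Z ω)) ^ 2)
  set A₂ := √(∑ i, ψ (Dμ θ₀ i) ^ 2)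
  set S₁ := √(⨆ θ ∈ Θ, frob (fun i j => D2μ θ i j (Z ω)) ^ 2)
  set S₂ := √(⨆ θ ∈ Θ, frob (fun i j => ψ (D2μ θ i j)) ^ 2)
  have hx0 : 0 ≤ x := norm_nonneg _
  have hA₁0 : 0 ≤ A₁ := Real.sqrt_nonneg _
  have hA₂0 : 0 ≤ A₂ := Real.sqrt_nonneg _
  have hS₁0 : 0 ≤ S₁ := Real.sqrt_nonneg _
  have hS₂0 : 0 ≤ S₂ := Real.sqrt_nonneg _
  have hnoise : (μf θ - μf θ₀) (Z ω) + ψ (μf θ - μf θ₀) ≤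
      (1 + d) * x * (A₁ + S₁ + A₂ + S₂) := by
    have q1 : x ^ 2 * (S₁ + S₂) ≤ d * x * (S₁ + S₂) := by
      rw [sq]; gcongr
    have q2 : 0 ≤ d * x * (A₁ + A₂) + x * (S₁ + S₂) := by positivity
    linarith [le_of_abs_le hT₁, le_of_abs_le hT₂]
  have hquad : κ * ‖μf θ - μf θ₀‖ * (‖μf θ₀‖ + 1 / 2 * ‖μf θ - μf θ₀‖) ≤
      C₁ * (‖μf θ₀‖ + C₁ * d) * x * κ := by
    have hδd : 1 / 2 * ‖μf θ - μf θ₀‖ ≤ C₁ * d := by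
      have : C₁ * x ≤ C₁ * d := by gcongr
      linarith [norm_nonneg (μf θ - μf θ₀)]
    calc κ * ‖μf θ - μf θ₀‖ * (‖μf θ₀‖ + 1 / 2 * ‖μf θ - μf θ₀‖)
        ≤ κ * (C₁ * x) * (‖μf θ₀‖ + C₁ * d) := by
          exact mul_le_mul (by gcongr) (by gcongr) (by positivity) (by positivity)
      _ = _ := by ring
  have hnoise' := mul_le_mul_of_nonneg_left hnoise hε.le
  have hrest : 0 ≤ C₁ * (‖μf θ₀‖ + C₁ * d) * x * (ε * (A₁ + S₁ + A₂ + S₂)) + (1 + d) * x * κ := by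
    positivity
  rw [hM]
  linarith
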